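/- Let Q ≥ 1 and let A be a Q×Q complex matrix that is Hermitian and positive definite. Then the set of real numbers { ∑_{q=0}^{Q-1} 1/Re(γ_qᴴ A γ_q) : Υ ∈ Matrix.unitaryGroup (Fin Q) ℂ with columns γ_q } has a greatest element, and this greatest element equals Re(trace(A⁻¹)). (IsGreatest statement: the maximum over unitary matrices of ∑_q 1/(γ_qᴴ A γ_q) is tr(A⁻¹), attained by a unitary matrix of eigenvectors of A.) -/

import Mathlib

open Matrix ComplexOrder

/-- Diagonal entries of a conjugate by `U` are the values of the quadratic form on the columns
of `U`. -/
lemma star_col_dotProduct_mulVec_col {n : Type*} [Fintype n] (A U : Matrix n n ℂ) (q : n) :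
    (star (fun i => U i q) ⬝ᵥ A.mulVec fun i => U i q) = (Uᴴ * A * U) q q := by
  rw [Matrix.mul_assoc]
  rfl

/-- For a positive definite matrix `B`, the diagonal entries of `B` and `B⁻¹` satisfy
`1 / B q q ≤ B⁻¹ q q`. -/
lemma Matrix.PosDef.one_div_re_diag_le_re_inv_diag {n : Type*} [Fintype n] [DecidableEq n]
    {B : Matrix n n ℂ} (hB : B.PosDef) (q : n) : 1 / (B q q).re ≤ (B⁻¹ q q).re := by
  have hdet : IsUnit B.det := (Matrix.isUnit_iff_isUnit_det B).mp hB.isUnit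
  have hpos : 0 < (B q q).re := (Complex.pos_iff.mp hB.diag_pos).1
  set t : ℝ := 1 / (B q q).re
  have hC : (B⁻¹ - t • (1 : Matrix n n ℂ))ᴴ * B * (B⁻¹ - t • (1 : Matrix n n ℂ))
      = B⁻¹ - (2 * t) • (1 : Matrix n n ℂ) + (t * t) • B := by
    have hH : (B⁻¹ - t • (1 : Matrix n n ℂ))ᴴ = B⁻¹ - t • (1 : Matrix n n ℂ) := by
      rw [conjTranspose_sub, conjTranspose_smul, hB.inv.isHermitian.eq]
      simp
    rw [hH, sub_mul, Matrix.nonsing_inv_mul B hdet]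
    simp only [sub_mul, mul_sub, Matrix.smul_mul, Matrix.mul_smul, one_mul, mul_one,
      Matrix.mul_nonsing_inv B hdet, smul_smul]
    module
  have h := (hB.posSemidef.conjTranspose_mul_mul_same
    (B⁻¹ - t • (1 : Matrix n n ℂ))).diag_nonneg (i := q)
  rw [hC] at h
  have hre := (Complex.nonneg_iff.mp h).1
  simp only [Matrix.add_apply, Matrix.sub_apply, Matrix.smul_apply, Matrix.one_apply_eq,
    Complex.add_re, Complex.sub_re, Complex.smul_re, Complex.one_re, smul_eq_mul, mul_one] at hre
  have htb : t * (B q q).re = 1 := by exact one_div_mul_cancel hpos.ne'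
  rw [mul_assoc, htb] at hre
  linarith

/-- Lemma 1 of the paper (full statement): for a Hermitian positive definite
`Q × Q` complex matrix `A`, the set of values `∑ q, 1 / Re(γ_qᴴ A γ_q)`, as `Υ`
ranges over unitary matrices with columns `γ_q`, has `Re(trace A⁻¹)` as its
greatest element. -/
theorem adaf_lemma1_isGreatest {Q : ℕ} (hQ : 1 ≤ Q) (A : Matrix (Fin Q) (Fin Q) ℂ)
    (hA : A.IsHermitian) (hApd : A.PosDef) :
    IsGreatest
      {x : ℝ | ∃ Υ : Matrix (Fin Q) (Fin Q) ℂ, Υ ∈ Matrix.unitaryGroup (Fin Q) ℂ ∧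
        x = ∑ q : Fin Q, 1 / (star (fun i => Υ i q) ⬝ᵥ A.mulVec fun i => Υ i q).re}
      (A⁻¹.trace).re := by
  have hinv : ∀ U ∈ Matrix.unitaryGroup (Fin Q) ℂ, (Uᴴ * A * U)⁻¹ = Uᴴ * A⁻¹ * U := by
    intro U hU
    have h1 : U⁻¹ = Uᴴ := Matrix.inv_eq_left_inv (Matrix.mem_unitaryGroup_iff'.mp hU)
    have h2 : (Uᴴ)⁻¹ = U := Matrix.inv_eq_left_inv (Matrix.mem_unitaryGroup_iff.mp hU)
    rw [Matrix.mul_inv_rev, Matrix.mul_inv_rev, h1, h2, Matrix.mul_assoc]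
  have htrace : ∀ U ∈ Matrix.unitaryGroup (Fin Q) ℂ,
      (A⁻¹.trace).re = ∑ q, ((Uᴴ * A * U)⁻¹ q q).re := by
    intro U hU
    have h : A⁻¹.trace = ((Uᴴ * A * U)⁻¹).trace := by
      have h1 : U * Uᴴ = 1 := Matrix.mem_unitaryGroup_iff.mp hU
      rw [hinv U hU, Matrix.trace_mul_cycle, h1, Matrix.one_mul]
    rw [h, Matrix.trace, Complex.re_sum]
    rfl
  refine ⟨⟨hA.eigenvectorUnitary, hA.eigenvectorUnitary.2, ?_⟩, ?_⟩
  · rw [htrace _ hA.eigenvectorUnitary.2]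
    have hdiag : (hA.eigenvectorUnitary : Matrix (Fin Q) (Fin Q) ℂ)ᴴ * A * hA.eigenvectorUnitary
        = diagonal (fun i => (hA.eigenvalues i : ℂ)) := by
      have h := hA.conjStarAlgAut_star_eigenvectorUnitary
      rw [Unitary.conjStarAlgAut_star_apply] at h
      exact h
    have hdinv : (diagonal (fun i => (hA.eigenvalues i : ℂ)))⁻¹
        = diagonal (fun i => ((hA.eigenvalues i)⁻¹ : ℂ)) := by
      refine Matrix.inv_eq_left_inv ?_
      rw [diagonal_mul_diagonal, ← diagonal_one]
      congr 1
      ext i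
      exact inv_mul_cancel₀ (Complex.ofReal_ne_zero.mpr (hApd.eigenvalues_pos i).ne')
    refine Finset.sum_congr rfl fun q _ => ?_
    rw [star_col_dotProduct_mulVec_col, hdiag, hdinv, diagonal_apply_eq, diagonal_apply_eq,
      ← Complex.ofReal_inv, Complex.ofReal_re, Complex.ofReal_re, one_div]
  · rintro x ⟨U, hU, rfl⟩
    rw [htrace U hU]
    have hinj : Function.Injective U.mulVec :=
      Matrix.mulVec_injective_of_isUnit (Unitary.isUnit_coe (U := ⟨U, hU⟩))
    refine Finset.sum_le_sum fun q _ => ?_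
    rw [star_col_dotProduct_mulVec_col]
    exact (hApd.conjTranspose_mul_mul_same hinj).one_div_re_diag_le_re_inv_diag q
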